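/- arXiv:1605.04747 — 2 statements merged into one kernel-verified Lean document; each statement's English description precedes it below -/
import Mathlib

section
/- Define S̃ : ℝ⁶ → ℝ by S̃(x,y,z,u,v,w) = x² + y² + z² − u²(ux−y)² − 2u²(vx−wy)² − w²(wy−z)² − (v²x − w²uy + (wu−v)z)². Then the set of points (x,y,z,u,v,w) ∈ ℝ⁶ with x > 0, y > 0, z > 0 satisfying the system x·∂S̃/∂x = 2, y·∂S̃/∂y = 2, z·∂S̃/∂z = 2, ∂S̃/∂u = 0, ∂S̃/∂v = 0, ∂S̃/∂w = 0, has exactly 29 elements. -/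
/-- The (normalized) scalar curvature function for n = 3. -/
noncomputable def Stilde (x y z u v w : ℝ) : ℝ :=
  x ^ 2 + y ^ 2 + z ^ 2 - u ^ 2 * (u * x - y) ^ 2 - 2 * u ^ 2 * (v * x - w * y) ^ 2 -
    w ^ 2 * (w * y - z) ^ 2 - (v ^ 2 * x - w ^ 2 * u * y + (w * u - v) * z) ^ 2

/-- The critical point system: x·∂S̃/∂x = 2, y·∂S̃/∂y = 2, z·∂S̃/∂z = 2,
∂S̃/∂u = ∂S̃/∂v = ∂S̃/∂w = 0, with x, y, z > 0. -/
def CriticalPoint (x y z u v w : ℝ) : Prop :=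
  0 < x ∧ 0 < y ∧ 0 < z ∧
    x * deriv (fun t => Stilde t y z u v w) x = 2 ∧
    y * deriv (fun t => Stilde x t z u v w) y = 2 ∧
    z * deriv (fun t => Stilde x y t u v w) z = 2 ∧
    deriv (fun t => Stilde x y z t v w) u = 0 ∧
    deriv (fun t => Stilde x y z u t w) v = 0 ∧
    deriv (fun t => Stilde x y z u v t) w = 0

/-- The critical point equations in the scale-invariant coordinates `a = u x / y`, `b = w y / z`,
`c = v x / z` and the squares `X = x ^ 2`, `Y = y ^ 2`, `Z = z ^ 2`, with denominators cleared. -/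
structure InvariantSystem (a b c X Y Z : ℝ) : Prop where
  posX : 0 < X
  posY : 0 < Y
  posZ : 0 < Z
  eqX : X ^ 2 + (a * (a - 1)) ^ 2 * Y ^ 2 + 2 * (a * (c - b)) ^ 2 * Y * Z
    + (c * (c - 1) - a * (b * (b - 1))) ^ 2 * Z ^ 2 = X
  eqY : X * Y ^ 2 - 2 * (a * (a - 1)) ^ 2 * Y ^ 3 - 2 * (a * (c - b)) ^ 2 * Y ^ 2 * Z
    + (b * (b - 1)) ^ 2 * Z ^ 2 * X = X * Y
  eqZ : X * Y * Z - 2 * (a * (c - b)) ^ 2 * Y ^ 2 * Z - 2 * (b * (b - 1)) ^ 2 * Z ^ 2 * X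
    - 2 * (c * (c - 1) - a * (b * (b - 1))) ^ 2 * Z ^ 2 * Y = X * Y
  eqa : a * (a - 1) * (2 * a - 1) * Y ^ 2 + 2 * a * (c - b) ^ 2 * Y * Z
    - (c * (c - 1) - a * (b * (b - 1))) * (b * (b - 1)) * Z ^ 2 = 0
  eqb : -2 * (a * (c - b)) * a * Y ^ 2 + b * (b - 1) * (2 * b - 1) * Z * X
    - a * (c * (c - 1) - a * (b * (b - 1))) * (2 * b - 1) * Z * Y = 0
  eqc : 2 * a * (a * (c - b)) * Y + (c * (c - 1) - a * (b * (b - 1))) * (2 * c - 1) * Z = 0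

/-- The solutions `(a, b, c, X, Y, Z)` of the invariant system. -/
def invariantSolutions : Finset (ℚ × ℚ × ℚ × ℚ × ℚ × ℚ) :=
  {(0, 0, 0, 1, 1, 1), (0, 0, 1, 1, 1, 1), (0, 1, 0, 1, 1, 1), (0, 1, 1, 1, 1, 1),
    (0, 0, 1/2, 1/2, 1, 2), (0, 0, 1/2, 9/10, 1, 6/5),
    (0, 1, 1/2, 1/2, 1, 2), (0, 1, 1/2, 9/10, 1, 6/5),
    (0, 1/2, 0, 1, 1/2, 2), (0, 1/2, 0, 1, 9/10, 6/5),
    (0, 1/2, 1, 1, 1/2, 2), (0, 1/2, 1, 1, 9/10, 6/5),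
    (5/19, 3/11, 6/11, 9/19, 57/55, 11/5), (5/19, 8/11, 5/11, 9/19, 57/55, 11/5),
    (1/3, 1/2, 1/2, 1/3, 3/2, 2), (1/3, 1/2, 1/2, 8/9, 1, 4/3),
    (9/19, 1/2, 1/2, 9/19, 19/10, 6/5),
    (1/2, 0, 0, 1/2, 2, 1), (1/2, 0, 0, 9/10, 6/5, 1),
    (1/2, 1, 1, 1/2, 2, 1), (1/2, 1, 1, 9/10, 6/5, 1),
    (1/2, 1/3, 2/3, 1/2, 2/3, 3), (1/2, 2/3, 1/3, 1/2, 2/3, 3),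
    (1/2, 5/11, 8/11, 9/10, 6/11, 11/5), (1/2, 6/11, 3/11, 9/10, 6/11, 11/5),
    (1, 0, 0, 1, 1, 1), (1, 1, 1, 1, 1, 1),
    (1, 1/2, 1/2, 1, 1/2, 2), (1, 1/2, 1/2, 1, 9/10, 6/5)}

/-- `(a, b, c, X, Y, Z)` is one of the rational points in `invariantSolutions`. -/
def IsListed (a b c X Y Z : ℝ) : Prop :=
  ∃ q ∈ invariantSolutions, a = q.1 ∧ b = q.2.1 ∧ c = q.2.2.1 ∧
    X = q.2.2.2.1 ∧ Y = q.2.2.2.2.1 ∧ Z = q.2.2.2.2.2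

theorem card_invariantSolutions : invariantSolutions.card = 29 := by
  decide +kernel

theorem invariantSystem_of_mem {q : ℚ × ℚ × ℚ × ℚ × ℚ × ℚ} (hq : q ∈ invariantSolutions) :
    InvariantSystem q.1 q.2.1 q.2.2.1 q.2.2.2.1 q.2.2.2.2.1 q.2.2.2.2.2 := by
  simp only [invariantSolutions, Finset.mem_insert, Finset.mem_singleton] at hq
  rcases hq with rfl | rfl | rfl | rfl | rfl | rfl | rfl | rfl | rfl | rfl | rfl | rfl | rfl | rfl |
    rfl | rfl | rfl | rfl | rfl | rfl | rfl | rfl | rfl | rfl | rfl | rfl | rfl | rfl | rfl <;>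
  constructor <;> norm_num

theorem deriv_Stilde_x (x y z u v w : ℝ) : deriv (fun t => Stilde t y z u v w) x =
    2 * x - 2 * u ^ 3 * (u * x - y) - 4 * u ^ 2 * v * (v * x - w * y)
      - 2 * v ^ 2 * (v ^ 2 * x - w ^ 2 * u * y + (w * u - v) * z) := by
  unfold Stilde
  simp (disch := fun_prop) [deriv_fun_sub, deriv_fun_add, deriv_fun_mul, deriv_fun_pow]
  ring

theorem deriv_Stilde_y (x y z u v w : ℝ) : deriv (fun t => Stilde x t z u v w) y =
    2 * y + 2 * u ^ 2 * (u * x - y) + 4 * u ^ 2 * w * (v * x - w * y) - 2 * w ^ 3 * (w * y - z)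
      + 2 * w ^ 2 * u * (v ^ 2 * x - w ^ 2 * u * y + (w * u - v) * z) := by
  unfold Stilde
  simp (disch := fun_prop) [deriv_fun_sub, deriv_fun_add, deriv_fun_mul, deriv_fun_pow]
  ring

theorem deriv_Stilde_z (x y z u v w : ℝ) : deriv (fun t => Stilde x y t u v w) z =
    2 * z + 2 * w ^ 2 * (w * y - z)
      - 2 * (w * u - v) * (v ^ 2 * x - w ^ 2 * u * y + (w * u - v) * z) := by
  unfold Stilde
  simp (disch := fun_prop) [deriv_fun_sub, deriv_fun_add, deriv_fun_mul, deriv_fun_pow]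
  ring

theorem deriv_Stilde_u (x y z u v w : ℝ) : deriv (fun t => Stilde x y z t v w) u =
    -2 * u * (u * x - y) ^ 2 - 2 * u ^ 2 * x * (u * x - y) - 4 * u * (v * x - w * y) ^ 2
      - 2 * (v ^ 2 * x - w ^ 2 * u * y + (w * u - v) * z) * (w * z - w ^ 2 * y) := by
  unfold Stilde
  simp (disch := fun_prop) [deriv_fun_sub, deriv_fun_add, deriv_fun_mul, deriv_fun_pow]
  ring

theorem deriv_Stilde_v (x y z u v w : ℝ) : deriv (fun t => Stilde x y z u t w) v =
    -4 * u ^ 2 * x * (v * x - w * y)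
      - 2 * (v ^ 2 * x - w ^ 2 * u * y + (w * u - v) * z) * (2 * v * x - z) := by
  unfold Stilde
  simp (disch := fun_prop) [deriv_fun_sub, deriv_fun_add, deriv_fun_mul, deriv_fun_pow]
  ring

theorem deriv_Stilde_w (x y z u v w : ℝ) : deriv (fun t => Stilde x y z u v t) w =
    4 * u ^ 2 * y * (v * x - w * y) - 2 * w * (w * y - z) ^ 2 - 2 * w ^ 2 * y * (w * y - z)
      - 2 * (v ^ 2 * x - w ^ 2 * u * y + (w * u - v) * z) * (u * z - 2 * w * u * y) := by
  unfold Stilde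
  simp (disch := fun_prop) [deriv_fun_sub, deriv_fun_add, deriv_fun_mul, deriv_fun_pow]
  ring

theorem criticalPoint_iff {x y z u v w : ℝ} (hx : 0 < x) (hy : 0 < y) (hz : 0 < z) :
    CriticalPoint x y z u v w ↔
      InvariantSystem (u * x / y) (w * y / z) (v * x / z) (x ^ 2) (y ^ 2) (z ^ 2) := by
  unfold CriticalPoint
  have hx' := deriv_Stilde_x x y z u v w
  have hy' := deriv_Stilde_y x y z u v w
  have hz' := deriv_Stilde_z x y z u v w
  have hu' := deriv_Stilde_u x y z u v w
  have hv' := deriv_Stilde_v x y z u v w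
  have hw' := deriv_Stilde_w x y z u v w
  generalize deriv (fun t => Stilde t y z u v w) x = Sx at *
  generalize deriv (fun t => Stilde x t z u v w) y = Sy at *
  generalize deriv (fun t => Stilde x y t u v w) z = Sz at *
  generalize deriv (fun t => Stilde x y z t v w) u = Su at *
  generalize deriv (fun t => Stilde x y z u t w) v = Sv at *
  generalize deriv (fun t => Stilde x y z u v t) w = Sw at *
  have IX :
      (x ^ 2) ^ 2 + ((u * x / y) * ((u * x / y) - 1)) ^ 2 * (y ^ 2) ^ 2 + 2 * ((u * x / y)
      * ((v * x / z) - (w * y / z))) ^ 2 * (y ^ 2) * (z ^ 2) + ((v * x / z) * ((v * x / z)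
      - 1) - (u * x / y) * ((w * y / z) * ((w * y / z) - 1))) ^ 2 * (z ^ 2) ^ 2 - (x ^ 2) =
      x ^ 2 / 2 * (x * Sx - 2 - u * Su - v * Sv) := by
    rw [hx', hu', hv']; field_simp; ring
  have IY :
      (x ^ 2) * (y ^ 2) ^ 2 - 2 * ((u * x / y) * ((u * x / y) - 1)) ^ 2 * (y ^ 2) ^ 3 - 2 *
      ((u * x / y) * ((v * x / z) - (w * y / z))) ^ 2 * (y ^ 2) ^ 2 * (z ^ 2) + ((w * y /
      z) * ((w * y / z) - 1)) ^ 2 * (z ^ 2) ^ 2 * (x ^ 2) - ((x ^ 2) * (y ^ 2)) =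
      x ^ 2 * y ^ 2 / 2 * (y * Sy - 2 + u * Su - w * Sw) := by
    rw [hy', hu', hw']; field_simp; ring
  have IZ :
      (x ^ 2) * (y ^ 2) * (z ^ 2) - 2 * ((u * x / y) * ((v * x / z) - (w * y / z))) ^ 2 *
      (y ^ 2) ^ 2 * (z ^ 2) - 2 * ((w * y / z) * ((w * y / z) - 1)) ^ 2 * (z ^ 2) ^ 2 * (x
      ^ 2) - 2 * ((v * x / z) * ((v * x / z) - 1) - (u * x / y) * ((w * y / z) * ((w * y /
      z) - 1))) ^ 2 * (z ^ 2) ^ 2 * (y ^ 2) - ((x ^ 2) * (y ^ 2)) =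
      x ^ 2 * y ^ 2 / 2 * (z * Sz - 2 + v * Sv + w * Sw) := by
    rw [hz', hv', hw']; field_simp; ring
  have Ia :
      (u * x / y) * ((u * x / y) - 1) * (2 * (u * x / y) - 1) * (y ^ 2) ^ 2 + 2 * (u * x /
      y) * ((v * x / z) - (w * y / z)) ^ 2 * (y ^ 2) * (z ^ 2) - ((v * x / z) * ((v * x /
      z) - 1) - (u * x / y) * ((w * y / z) * ((w * y / z) - 1))) * ((w * y / z) * ((w * y /
      z) - 1)) * (z ^ 2) ^ 2 = -(x * y / 2) * Su := by
    rw [hu']; field_simp; ring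
  have Ib :
      -2 * ((u * x / y) * ((v * x / z) - (w * y / z))) * (u * x / y) * (y ^ 2) ^ 2 + (w * y
      / z) * ((w * y / z) - 1) * (2 * (w * y / z) - 1) * (z ^ 2) * (x ^ 2) - (u * x / y) *
      ((v * x / z) * ((v * x / z) - 1) - (u * x / y) * ((w * y / z) * ((w * y / z) - 1))) *
      (2 * (w * y / z) - 1) * (z ^ 2) * (y ^ 2) = -(x ^ 2 * y / (2 * z)) * Sw := by
    rw [hw']; field_simp; ring
  have Ic :
      2 * (u * x / y) * ((u * x / y) * ((v * x / z) - (w * y / z))) * (y ^ 2) + ((v * x /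
      z) * ((v * x / z) - 1) - (u * x / y) * ((w * y / z) * ((w * y / z) - 1))) * (2 * (v *
      x / z) - 1) * (z ^ 2) = -(x / (2 * z)) * Sv := by
    rw [hv']; field_simp; ring
  clear hx' hy' hz' hu' hv' hw'
  constructor
  · rintro ⟨-, -, -, h1, h2, h3, rfl, rfl, rfl⟩
    refine ⟨pow_pos hx 2, pow_pos hy 2, pow_pos hz 2, ?_, ?_, ?_, ?_, ?_, ?_⟩
    · linear_combination IX + x ^ 2 / 2 * h1
    · linear_combination IY + x ^ 2 * y ^ 2 / 2 * h2
    · linear_combination IZ + x ^ 2 * y ^ 2 / 2 * h3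
    · linear_combination Ia
    · linear_combination Ib
    · linear_combination Ic
  · rintro ⟨-, -, -, h1, h2, h3, h4, h5, h6⟩
    rw [h1, sub_self] at IX
    rw [h2, sub_self] at IY
    rw [h3, sub_self] at IZ
    rw [h4] at Ia
    rw [h5] at Ib
    rw [h6] at Ic
    obtain rfl : Su = 0 := by simpa [hx.ne', hy.ne'] using Ia.symm
    obtain rfl : Sw = 0 := by simpa [hx.ne', hy.ne', hz.ne'] using Ib.symm
    obtain rfl : Sv = 0 := by simpa [hx.ne', hz.ne'] using Ic.symm
    refine ⟨hx, hy, hz, ?_, ?_, ?_, rfl, rfl, rfl⟩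
    · apply mul_left_cancel₀ (pow_pos hx 2).ne'
      linear_combination -2 * IX
    · apply mul_left_cancel₀ (mul_pos (pow_pos hx 2) (pow_pos hy 2)).ne'
      linear_combination -2 * IY
    · apply mul_left_cancel₀ (mul_pos (pow_pos hx 2) (pow_pos hy 2)).ne'
      linear_combination -2 * IZ

/-- Systems of this shape occur whenever only one of the off-diagonal coefficients survives. -/
theorem eq_of_two_variable_system {P Q : ℝ} (hP : 0 < P) (hQ : 0 < Q)
    (h₁ : P ^ 2 + Q ^ 2 / 16 = P) (h₂ : P * Q - Q ^ 2 / 8 = P) :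
    (P = 1 / 2 ∧ Q = 2) ∨ (P = 9 / 10 ∧ Q = 6 / 5) := by
  have h : (4 * P - Q) * (4 * P - 3 * Q) = 0 := by linear_combination 16 * h₁ - 16 * h₂
  rcases mul_eq_zero.1 h with h | h
  · have hQ' : Q = 4 * P := by linarith
    subst hQ'
    left
    have : P * (2 * P - 1) = 0 := by linear_combination h₁
    have : P = 1 / 2 := by
      rcases mul_eq_zero.1 this with h | h <;> linarith
    constructor <;> linarith
  · have hQ' : Q = 4 / 3 * P := by linarith
    subst hQ'
    right
    have : P * (10 * P - 9) = 0 := by linear_combination 9 * h₁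
    have : P = 9 / 10 := by
      rcases mul_eq_zero.1 this with h | h <;> linarith
    constructor <;> linarith

theorem eq_zero_or_one_of_mul {b : ℝ} (h : b * (b - 1) = 0) : b = 0 ∨ b = 1 := by
  rcases mul_eq_zero.1 h with h | h
  · exact Or.inl h
  · exact Or.inr (by linarith)

theorem InvariantSystem.isListed_of_a_eq_zero {b c X Y Z : ℝ} (h : InvariantSystem 0 b c X Y Z) :
    IsListed 0 b c X Y Z := by
  obtain ⟨hX, hY, hZ, h1, h2, h3, h4, h5, h6⟩ := h
  have hc : c * (c - 1) * (2 * c - 1) = 0 := by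
    refine (mul_eq_zero.1 (show c * (c - 1) * (2 * c - 1) * Z = 0 by
      linear_combination h6)).resolve_right hZ.ne'
  have hb : b * (b - 1) * (2 * b - 1) = 0 := by
    refine (mul_eq_zero.1 (show b * (b - 1) * (2 * b - 1) * (Z * X) = 0 by
      linear_combination h5)).resolve_right (by positivity)
  have hbc : c * (c - 1) * (b * (b - 1)) = 0 := by
    refine (mul_eq_zero.1 (show c * (c - 1) * (b * (b - 1)) * Z ^ 2 = 0 by
      linear_combination -h4)).resolve_right (by positivity)
  rcases mul_eq_zero.1 hb with hB | hb
  · have hY1 : Y = 1 := by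
      apply mul_left_cancel₀ (mul_pos hX hY).ne'
      linear_combination h2 - b * (b - 1) * Z ^ 2 * X * hB
    subst hY1
    rcases mul_eq_zero.1 hc with hC | hc
    · have hX1 : X = 1 := by
        apply mul_left_cancel₀ hX.ne'
        linear_combination h1 - c * (c - 1) * Z ^ 2 * hC
      subst hX1
      have hZ1 : Z = 1 := by
        linear_combination h3 + 2 * (b * (b - 1)) * Z ^ 2 * hB + 2 * (c * (c - 1)) * Z ^ 2 * hC
      subst hZ1
      rcases eq_zero_or_one_of_mul hB with rfl | rfl <;>
      rcases eq_zero_or_one_of_mul hC with rfl | rfl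
      · exact ⟨(0, 0, 0, 1, 1, 1), by decide +kernel, by norm_num⟩
      · exact ⟨(0, 0, 1, 1, 1, 1), by decide +kernel, by norm_num⟩
      · exact ⟨(0, 1, 0, 1, 1, 1), by decide +kernel, by norm_num⟩
      · exact ⟨(0, 1, 1, 1, 1, 1), by decide +kernel, by norm_num⟩
    · obtain rfl : c = 1 / 2 := by linarith
      have := eq_of_two_variable_system hX hZ (by linear_combination h1)
        (by linear_combination h3 + 2 * (b * (b - 1)) * Z ^ 2 * X * hB)
      rcases eq_zero_or_one_of_mul hB with rfl | rfl <;> rcases this with ⟨rfl, rfl⟩ | ⟨rfl, rfl⟩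
      · exact ⟨(0, 0, 1/2, 1/2, 1, 2), by decide +kernel, by norm_num⟩
      · exact ⟨(0, 0, 1/2, 9/10, 1, 6/5), by decide +kernel, by norm_num⟩
      · exact ⟨(0, 1, 1/2, 1/2, 1, 2), by decide +kernel, by norm_num⟩
      · exact ⟨(0, 1, 1/2, 9/10, 1, 6/5), by decide +kernel, by norm_num⟩
  · obtain rfl : b = 1 / 2 := by linarith
    have hC : c * (c - 1) = 0 := by linarith
    have hX1 : X = 1 := by
      apply mul_left_cancel₀ hX.ne'
      linear_combination h1 - c * (c - 1) * Z ^ 2 * hC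
    subst hX1
    have := eq_of_two_variable_system hY hZ (by linear_combination h2)
      (by linear_combination h3 + 2 * (c * (c - 1)) * Z ^ 2 * Y * hC)
    rcases eq_zero_or_one_of_mul hC with rfl | rfl <;> rcases this with ⟨rfl, rfl⟩ | ⟨rfl, rfl⟩
    · exact ⟨(0, 1/2, 0, 1, 1/2, 2), by decide +kernel, by norm_num⟩
    · exact ⟨(0, 1/2, 0, 1, 9/10, 6/5), by decide +kernel, by norm_num⟩
    · exact ⟨(0, 1/2, 1, 1, 1/2, 2), by decide +kernel, by norm_num⟩
    · exact ⟨(0, 1/2, 1, 1, 9/10, 6/5), by decide +kernel, by norm_num⟩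

/-- The case `b = c = 1 / 2`, where the symmetry `(b, c) ↦ (1 - b, 1 - c)` has its fixed points. -/
theorem InvariantSystem.isListed_of_b_c_eq_half {a X Y Z : ℝ} (ha : a ≠ 0)
    (h : InvariantSystem a (1 / 2) (1 / 2) X Y Z) : IsListed a (1 / 2) (1 / 2) X Y Z := by
  obtain ⟨hX, hY, hZ, h1, h2, h3, h4, -, -⟩ := h
  have h4' : (a - 1) * (16 * a * (2 * a - 1) * Y ^ 2 + Z ^ 2) = 0 := by
    linear_combination 16 * h4
  rcases mul_eq_zero.1 h4' with ha1 | hq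
  · obtain rfl : a = 1 := by linarith
    have hX1 : X = 1 := by
      apply mul_left_cancel₀ hX.ne'
      linear_combination h1
    subst hX1
    rcases eq_of_two_variable_system hY hZ (by linear_combination h2)
      (by linear_combination h3) with ⟨rfl, rfl⟩ | ⟨rfl, rfl⟩
    · exact ⟨(1, 1/2, 1/2, 1, 1/2, 2), by decide +kernel, by norm_num⟩
    · exact ⟨(1, 1/2, 1/2, 1, 9/10, 6/5), by decide +kernel, by norm_num⟩
  have hneg : a * (2 * a - 1) < 0 := by
    by_contra! hle
    nlinarith [mul_nonneg hle (sq_nonneg Y), pow_pos hZ 2]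
  have ha0 : 0 < a := by
    by_contra! hle
    nlinarith
  have ha2 : 2 * a < 1 := by
    by_contra! hle
    nlinarith
  have hZ2 : Z ^ 2 = 16 * a * (1 - 2 * a) * Y ^ 2 := by linear_combination hq
  have h1' : X ^ 2 + a * (1 - a) ^ 2 * (1 - a) * Y ^ 2 = X := by
    linear_combination h1 - (a - 1) ^ 2 / 16 * hZ2
  have h2' : X * Y - 2 * a ^ 2 * (1 - a) ^ 2 * Y ^ 2 + a * (1 - 2 * a) * Y * X = X := by
    apply mul_right_cancel₀ hY.ne'
    linear_combination h2 - X / 16 * hZ2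
  have h3' : X * Z - 2 * a * (1 - 2 * a) * X * Y - 2 * a * (1 - 2 * a) * (1 - a) ^ 2 * Y ^ 2 = X := by
    apply mul_right_cancel₀ hY.ne'
    linear_combination h3 + (X / 8 + (a - 1) ^ 2 * Y / 8) * hZ2
  have hfac : (X - a * (1 - a) * Y) * (X - (1 + a) * (1 - a) * Y) = 0 := by
    linear_combination h1' - h2'
  rcases mul_eq_zero.1 hfac with hXY | hXY
  · obtain rfl : X = a * (1 - a) * Y := by linarith
    have hYa : (1 - a) * Y = 1 := by
      have : 0 < a * (1 - a) * Y := hX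
      apply mul_left_cancel₀ this.ne'
      linear_combination h1'
    have hZY : Z = (3 - 5 * a) * Y := by
      apply mul_left_cancel₀ hX.ne'
      linear_combination h3' - h2'
    have hroot : (19 * a - 9) * (3 * a - 1) = 0 := by
      refine (mul_eq_zero.1 (show (19 * a - 9) * (3 * a - 1) * Y ^ 2 = 0 by
        rw [hZY] at hZ2; linear_combination hZ2)).resolve_right (by positivity)
    rcases mul_eq_zero.1 hroot with hr | hr
    · obtain rfl : a = 9 / 19 := by linarith
      obtain rfl : Y = 19 / 10 := by linarith
      subst hZY
      exact ⟨(9/19, 1/2, 1/2, 9/19, 19/10, 6/5), by decide +kernel, by norm_num⟩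
    · obtain rfl : a = 1 / 3 := by linarith
      obtain rfl : Y = 3 / 2 := by linarith
      subst hZY
      exact ⟨(1/3, 1/2, 1/2, 1/3, 3/2, 2), by decide +kernel, by norm_num⟩
  · obtain rfl : X = (1 + a) * (1 - a) * Y := by linarith
    have hYa : (1 - a) * (1 + 3 * a) * Y = 1 + a := by
      have : 0 < (1 + a) * (1 - a) * Y := hX
      apply mul_left_cancel₀ (mul_pos (sub_pos.2 (show a < 1 by linarith)) hY).ne'
      linear_combination h1'
    have hZY : (1 + a) * Z = (1 + 6 * a - 11 * a ^ 2) * Y := by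
      apply mul_left_cancel₀ (mul_pos (sub_pos.2 (show a < 1 by linarith)) hY).ne'
      linear_combination h3' - h2'
    have hroot : (3 * a - 1) ^ 2 * (17 * a ^ 2 + 2 * a + 1) = 0 := by
      refine (mul_eq_zero.1 (show (3 * a - 1) ^ 2 * (17 * a ^ 2 + 2 * a + 1) * Y ^ 2 = 0 by
        linear_combination (1 + a) ^ 2 * hZ2
          - ((1 + a) * Z + (1 + 6 * a - 11 * a ^ 2) * Y) * hZY)).resolve_right (by positivity)
    have hr : 3 * a - 1 = 0 := by
      rcases mul_eq_zero.1 hroot with hr | hr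
      · exact pow_eq_zero_iff two_ne_zero |>.1 hr
      · have : 0 < 17 * a ^ 2 + 2 * a + 1 := by positivity
        exact absurd hr this.ne'
    obtain rfl : a = 1 / 3 := by linarith
    obtain rfl : Y = 1 := by linarith
    obtain rfl : Z = 4 / 3 := by linarith
    exact ⟨(1/3, 1/2, 1/2, 8/9, 1, 4/3), by decide +kernel, by norm_num⟩

theorem sextic_pos (t : ℝ) :
    0 < 5 * t ^ 6 - 26 * t ^ 5 + 79 * t ^ 4 - 140 * t ^ 3 + 167 * t ^ 2 - 114 * t + 45 := by
  have h : 5 * t ^ 6 - 26 * t ^ 5 + 79 * t ^ 4 - 140 * t ^ 3 + 167 * t ^ 2 - 114 * t + 45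
      = 8 + 8 * t ^ 2 + 4 * (t - 1) ^ 2 * (t + 1) ^ 2 + 12 * (t - 1) ^ 2 + 19 * (t - 1) ^ 4
        + (t - 1) ^ 4 * (2 * t - 1) ^ 2 + (t - 1) ^ 6 := by ring
  rw [h]
  have : 0 ≤ (t - 1) ^ 4 := by positivity
  have : 0 ≤ (t - 1) ^ 6 := by positivity
  positivity

/-- The elimination step for the generic solutions, in terms of `t = (2 b - 1) / (2 c - 1)`,
`k = Z / Y`, `h = (2 c - 1) ^ 2 k`, `m = b (b - 1) k` and `r = Y / X`. -/
theorem generic_parameters {a t m h k r : ℝ} (ht1 : 1 - t ≠ 0)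
    (hW : 1 - a * t ≠ 0) (hh : 0 < h)
    (hm : 4 * m = t ^ 2 * h - k)
    (hE : h - k = 4 * a * m - 4 * a ^ 2 * (1 - t))
    (ha : 2 * (a - 1) * (2 * a - 1) + (1 - t) ^ 2 * h + 2 * a * (1 - t) * m = 0)
    (hr : a ^ 2 * (1 - t) * r * (1 - a * t) = m * t)
    (hXY : 1 - r + (3 * a ^ 2 * (a - 1) ^ 2 + a ^ 2 * (1 - t) ^ 2 * h + a ^ 4 * (1 - t) ^ 2) * r ^ 2
      - m ^ 2 * r = 0)
    (hYZ : k - 1 + 2 * a ^ 2 * ((a - 1) ^ 2 - a ^ 2 * (1 - t) ^ 2) * r - 3 * m ^ 2 = 0) :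
    (a = 5 / 19 ∧ t = -5) ∨ (a = 1 / 2 ∧ t = -1) ∨ (a = 1 / 2 ∧ t = -1 / 5) := by
  obtain ⟨μ, hμ⟩ : ∃ μ, μ = (1 - t) * m := ⟨_, rfl⟩
  have I : (3 * a - 2 + a * t) * μ
      = 2 * a ^ 2 * (1 - t) ^ 2 - (a - 1) * (2 * a - 1) * (1 + t) := by
    rw [hμ]
    linear_combination (1 + t) / 2 * ha - (1 - t) / 2 * (hE + hm)
  have hn2h : (1 - t) ^ 2 * h = -2 * (a - 1) * (2 * a - 1) - 2 * a * μ := by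
    rw [hμ]; linear_combination ha
  have hYZ' : (k - 1) * (1 - t) - 2 * (2 * a - 1 - a * t) * m * t - 3 * (1 - t) * m ^ 2 = 0 := by
    linear_combination (1 - t) * hYZ + 2 * (2 * a - 1 - a * t) * hr
  have II : 3 * μ ^ 2 + 2 * μ * (3 * a - t - a * t ^ 2) + (1 - t) ^ 2
      + 2 * (a - 1) * (2 * a - 1) - 4 * a ^ 2 * (1 - t) ^ 3 = 0 := by
    rw [hμ]
    linear_combination -(1 - t) * hYZ' - (1 - t) ^ 2 * hE + ha
  have III : (1 - a ^ 2 + a ^ 2 * (1 - t) ^ 2 - 2 * a * μ) * (μ * t) ^ 2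
      - ((1 - t) ^ 2 + μ ^ 2) * (μ * t) * (1 - a * t)
      + a ^ 2 * (1 - t) ^ 4 * (1 - a * t) ^ 2 = 0 := by
    have hρ : μ * t = a ^ 2 * (1 - t) ^ 2 * r * (1 - a * t) := by
      rw [hμ]; linear_combination -(1 - t) * hr
    have hK : 1 - a ^ 2 + a ^ 2 * (1 - t) ^ 2 - 2 * a * μ
        = 3 * (a - 1) ^ 2 + (1 - t) ^ 2 * h + a ^ 2 * (1 - t) ^ 2 := by
      linear_combination -hn2h
    rw [hK, hρ, hμ]
    linear_combination a ^ 2 * (1 - t) ^ 4 * (1 - a * t) ^ 2 * hXY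
  have hP2 : (2 * a - 1) * (1 - a * t) ^ 2
      * (12 * a * (t ^ 2 - 2 * t + 3) - 3 * (t ^ 2 - 2 * t + 5)) = 0 := by
    obtain ⟨d, hd⟩ : ∃ d, d = 3 * a - 2 + a * t := ⟨_, rfl⟩
    obtain ⟨N, hN⟩ : ∃ N, N = 2 * a ^ 2 * (1 - t) ^ 2 - (a - 1) * (2 * a - 1) * (1 + t) := ⟨_, rfl⟩
    rw [← hd, ← hN] at I
    have : 3 * N ^ 2 + 2 * N * d * (3 * a - t - a * t ^ 2) + d ^ 2 * ((1 - t) ^ 2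
        + 2 * (a - 1) * (2 * a - 1) - 4 * a ^ 2 * (1 - t) ^ 3) = 0 := by
      rw [← I]; linear_combination d ^ 2 * II
    rw [hN, hd] at this
    linear_combination this
  have hP3 : (1 - t) * (1 - a * t) ^ 2 * (1 + t) * (-5*a^5*t^5 + 23*a^5*t^4 - 62*a^5*t^3
      + 90*a^5*t^2 - 81*a^5*t + 27*a^5 - 6*a^4*t^4 + 60*a^4*t^3 - 132*a^4*t^2 + 180*a^4*t - 54*a^4
      + 2*a^3*t^4 - 39*a^3*t^3 + 105*a^3*t^2 - 186*a^3*t + 36*a^3 + 9*a^2*t^3 - 47*a^2*t^2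
      + 104*a^2*t - 8*a^2 + 15*a*t^2 - 33*a*t - 3*t^2 + 5*t) = 0 := by
    obtain ⟨d, hd⟩ : ∃ d, d = 3 * a - 2 + a * t := ⟨_, rfl⟩
    obtain ⟨N, hN⟩ : ∃ N, N = 2 * a ^ 2 * (1 - t) ^ 2 - (a - 1) * (2 * a - 1) * (1 + t) := ⟨_, rfl⟩
    rw [← hd, ← hN] at I
    have : ((1 - a ^ 2 + a ^ 2 * (1 - t) ^ 2) * d - 2 * a * N) * N ^ 2 * t ^ 2
        - ((1 - t) ^ 2 * d ^ 2 + N ^ 2) * N * t * (1 - a * t)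
        + a ^ 2 * (1 - t) ^ 4 * (1 - a * t) ^ 2 * d ^ 3 = 0 := by
      rw [← I]; linear_combination d ^ 3 * III
    rw [hN, hd] at this
    linear_combination this
  have hQ2 : (2 * a - 1) * (4 * a * (t ^ 2 - 2 * t + 3) - (t ^ 2 - 2 * t + 5)) = 0 := by
    apply mul_left_cancel₀ (pow_ne_zero 2 hW)
    linear_combination hP2 / 3
  have hQ3 := (mul_eq_zero.1 hP3).imp_left fun h =>
    (mul_eq_zero.1 h).resolve_left (mul_ne_zero ht1 (pow_ne_zero 2 hW))
  rcases mul_eq_zero.1 hQ2 with ha' | ha'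
  · obtain rfl : a = 1 / 2 := by linarith
    rcases hQ3 with h | h
    · exact Or.inr (Or.inl ⟨rfl, by linarith⟩)
    · have : (1 - t) ^ 4 * (5 * t + 1) = 0 := by linear_combination -32 * h
      have := (mul_eq_zero.1 this).resolve_left (pow_ne_zero 4 ht1)
      exact Or.inr (Or.inr ⟨rfl, by linarith⟩)
  · clear hP2 hP3 hQ2 II III hXY hYZ hYZ' hr hm hE
    rcases hQ3 with h1 | h1
    · exfalso
      obtain rfl : t = -1 := by linarith
      obtain rfl : a = 1 / 3 := by linarith
      norm_num at ha hn2h I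
      linarith
    · left
      obtain ⟨D, hD⟩ : ∃ D, D = 4 * (t ^ 2 - 2 * t + 3) := ⟨_, rfl⟩
      obtain ⟨N, hN⟩ : ∃ N, N = t ^ 2 - 2 * t + 5 := ⟨_, rfl⟩
      have haD : a * D = N := by rw [hD, hN]; linear_combination ha'
      have ht3 : t - 3 ≠ 0 := by
        intro h0
        obtain rfl : t = 3 := by linarith
        apply hW
        linear_combination -ha' / 8
      have hhom : -5*N^5*t^5 + 23*N^5*t^4 - 62*N^5*t^3 + 90*N^5*t^2 - 81*N^5*t + 27*N^5
          - 6*N^4*D*t^4 + 60*N^4*D*t^3 - 132*N^4*D*t^2 + 180*N^4*D*t - 54*N^4*D + 2*N^3*D^2*t^4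
          - 39*N^3*D^2*t^3 + 105*N^3*D^2*t^2 - 186*N^3*D^2*t + 36*N^3*D^2 + 9*N^2*D^3*t^3
          - 47*N^2*D^3*t^2 + 104*N^2*D^3*t - 8*N^2*D^3 + 15*N*D^4*t^2 - 33*N*D^4*t
          - 3*D^5*t^2 + 5*D^5*t = 0 := by
        rw [← haD]; linear_combination D ^ 5 * h1
      have key : (t - 3) ^ 4 * (1 - t) ^ 4 * (5 * t ^ 6 - 26 * t ^ 5 + 79 * t ^ 4 - 140 * t ^ 3
          + 167 * t ^ 2 - 114 * t + 45) * (t + 5) = 0 := by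
        rw [hN, hD] at hhom
        linear_combination -hhom
      have ht5 := (mul_eq_zero.1 key).resolve_left
        (mul_ne_zero (mul_ne_zero (pow_ne_zero 4 ht3) (pow_ne_zero 4 ht1)) (sextic_pos t).ne')
      obtain rfl : t = -5 := by linarith
      exact ⟨by linarith, rfl⟩

theorem InvariantSystem.isListed_of_generic {a γ t X r k : ℝ} (ha : a ≠ 0) (hγ : γ ≠ 0)
    (hB : (t * γ) ^ 2 - 1 ≠ 0) (ht : t ≠ 0) (hE : γ ^ 2 - 1 - a * ((t * γ) ^ 2 - 1) ≠ 0)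
    (hr : 0 < r) (hk : 0 < k)
    (h : InvariantSystem a ((1 + t * γ) / 2) ((1 + γ) / 2) X (r * X) (k * (r * X))) :
    IsListed a ((1 + t * γ) / 2) ((1 + γ) / 2) X (r * X) (k * (r * X)) := by
  obtain ⟨hX, -, -, h1, h2, h3, h4, h5, h6⟩ := h
  obtain ⟨B, hB'⟩ : ∃ B, B = ((t * γ) ^ 2 - 1) / 4 := ⟨_, rfl⟩
  obtain ⟨E, hE'⟩ : ∃ E, E = (γ ^ 2 - 1 - a * ((t * γ) ^ 2 - 1)) / 4 := ⟨_, rfl⟩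
  have hB0 : B ≠ 0 := by rw [hB']; exact div_ne_zero hB (by norm_num)
  have hE0 : E ≠ 0 := by rw [hE']; exact div_ne_zero hE (by norm_num)
  have hbB : (1 + t * γ) / 2 * ((1 + t * γ) / 2 - 1) = B := by rw [hB']; ring
  have hcE : (1 + γ) / 2 * ((1 + γ) / 2 - 1) - a * B = E := by rw [hB', hE']; ring
  rw [hbB, hcE] at h1 h3 h4 h5 h6
  rw [hbB] at h2
  have e6 : E * k = -a ^ 2 * (1 - t) := by
    apply mul_right_cancel₀ (mul_pos hr hX).ne'
    apply mul_left_cancel₀ hγ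
    linear_combination h6
  have e5 : E * r * (1 - a * t) + B * t = 0 := by
    apply mul_left_cancel₀ (mul_pos (mul_pos hk hr) (pow_pos hX 2)).ne'
    apply mul_left_cancel₀ hγ
    linear_combination h5 + γ * r ^ 2 * X ^ 2 * e6
  have e4 : 2 * (a - 1) * (2 * a - 1) + (1 - t) ^ 2 * (γ ^ 2 * k)
      + 2 * a * (1 - t) * (B * k) = 0 := by
    apply mul_left_cancel₀ ha
    apply mul_left_cancel₀ (pow_pos (mul_pos hr hX) 2).ne'
    linear_combination 2 * h4 + 2 * B * k * (r * X) ^ 2 * e6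
  have ht1 : 1 - t ≠ 0 := by
    intro h0
    rw [h0, mul_zero] at e6
    exact mul_ne_zero hE0 hk.ne' e6
  have hW : 1 - a * t ≠ 0 := by
    intro h0
    rw [h0, mul_zero, zero_add] at e5
    exact mul_ne_zero hB0 ht e5
  have hEE : (E * k) ^ 2 = a ^ 4 * (1 - t) ^ 2 := by rw [e6]; ring
  have e1 : X * (1 + (a ^ 2 * (a - 1) ^ 2 + a ^ 2 * (1 - t) ^ 2 * (γ ^ 2 * k) / 2
      + a ^ 4 * (1 - t) ^ 2) * r ^ 2) = 1 := by
    apply mul_left_cancel₀ hX.ne'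
    linear_combination h1 - r ^ 2 * X ^ 2 * hEE
  have e2 : X * (1 - (2 * a ^ 2 * (a - 1) ^ 2 + a ^ 2 * (1 - t) ^ 2 * (γ ^ 2 * k) / 2) * r
      + (B * k) ^ 2) * r = 1 := by
    apply mul_left_cancel₀ (mul_pos hr (pow_pos hX 2)).ne'
    linear_combination h2
  have e3 : X * (k - a ^ 2 * (1 - t) ^ 2 * (γ ^ 2 * k) / 2 * r - 2 * (B * k) ^ 2
      - 2 * a ^ 4 * (1 - t) ^ 2 * r) * r = 1 := by
    apply mul_left_cancel₀ (mul_pos hr (pow_pos hX 2)).ne'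
    linear_combination h3 + 2 * r ^ 3 * X ^ 3 * hEE
  clear h1 h2 h3 h4 h5 h6
  have hh : 0 < γ ^ 2 * k := mul_pos (by positivity) hk
  have hm : 4 * (B * k) = t ^ 2 * (γ ^ 2 * k) - k := by rw [hB']; ring
  have hEk : γ ^ 2 * k - k = 4 * a * (B * k) - 4 * a ^ 2 * (1 - t) := by
    linear_combination 4 * e6 - 4 * k * hE' - 4 * a * k * hB'
  have hrm : a ^ 2 * (1 - t) * r * (1 - a * t) = B * k * t := by
    linear_combination -k * e5 + r * (1 - a * t) * e6
  have key := generic_parameters ht1 hW hh hm hEk e4 hrm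
    (by apply mul_left_cancel₀ hX.ne'; linear_combination e1 - e2)
    (by apply mul_left_cancel₀ (mul_pos hX hr).ne'; linear_combination e3 - e2)
  clear e2 e3 hE' hcE e6 e5 hEE hE0 hE hB0 hB hbB hB'
  obtain ⟨h, hh'⟩ : ∃ h, h = γ ^ 2 * k := ⟨_, rfl⟩
  obtain ⟨m, hm'⟩ : ∃ m, m = B * k := ⟨_, rfl⟩
  rw [← hh'] at e1 e4 hm hEk hh
  rw [← hm'] at e4 hm hEk hrm
  clear hm'
  rcases key with ⟨rfl, rfl⟩ | ⟨rfl, rfl⟩ | ⟨rfl, rfl⟩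
  · obtain rfl : m = -8 / 19 := by linarith
    obtain rfl : h = 1 / 57 := by linarith
    obtain rfl : k = 121 / 57 := by linarith
    obtain rfl : r = 361 / 165 := by linarith
    obtain rfl : X = 9 / 19 := by linarith
    have : (γ - 1 / 11) * (γ + 1 / 11) = 0 := by linarith
    rcases mul_eq_zero.1 this with hg | hg
    · obtain rfl : γ = 1 / 11 := by linarith
      exact ⟨(5/19, 3/11, 6/11, 9/19, 57/55, 11/5), by decide +kernel, by norm_num⟩
    · obtain rfl : γ = -1 / 11 := by linarith
      exact ⟨(5/19, 8/11, 5/11, 9/19, 57/55, 11/5), by decide +kernel, by norm_num⟩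
  · obtain rfl : m = -1 := by linarith
    obtain rfl : h = 1 / 2 := by linarith
    obtain rfl : k = 9 / 2 := by linarith
    obtain rfl : r = 4 / 3 := by linarith
    obtain rfl : X = 1 / 2 := by linarith
    have : (γ - 1 / 3) * (γ + 1 / 3) = 0 := by linarith
    rcases mul_eq_zero.1 this with hg | hg
    · obtain rfl : γ = 1 / 3 := by linarith
      exact ⟨(1/2, 1/3, 2/3, 1/2, 2/3, 3), by decide +kernel, by norm_num⟩
    · obtain rfl : γ = -1 / 3 := by linarith
      exact ⟨(1/2, 2/3, 1/3, 1/2, 2/3, 3), by decide +kernel, by norm_num⟩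
  · obtain rfl : m = -1 := by linarith
    obtain rfl : h = 5 / 6 := by linarith
    obtain rfl : k = 121 / 30 := by linarith
    obtain rfl : r = 20 / 33 := by linarith
    obtain rfl : X = 9 / 10 := by linarith
    have : (γ - 5 / 11) * (γ + 5 / 11) = 0 := by linarith
    rcases mul_eq_zero.1 this with hg | hg
    · obtain rfl : γ = 5 / 11 := by linarith
      exact ⟨(1/2, 5/11, 8/11, 9/10, 6/11, 11/5), by decide +kernel, by norm_num⟩
    · obtain rfl : γ = -5 / 11 := by linarith
      exact ⟨(1/2, 6/11, 3/11, 9/10, 6/11, 11/5), by decide +kernel, by norm_num⟩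

theorem InvariantSystem.isListed_of_b_eq_c {a b X Y Z : ℝ} (ha : a ≠ 0) (hB : b * (b - 1) = 0)
    (h : InvariantSystem a b b X Y Z) : IsListed a b b X Y Z := by
  obtain ⟨hX, hY, hZ, h1, h2, h3, h4, -, -⟩ := h
  simp only [hB, sub_self] at h1 h2 h3 h4
  have hZ1 : Z = 1 := by
    apply mul_left_cancel₀ (mul_pos hX hY).ne'
    linear_combination h3
  subst hZ1
  have ha' : (a - 1) * (2 * a - 1) = 0 := by
    apply mul_left_cancel₀ ha
    apply mul_left_cancel₀ (pow_pos hY 2).ne'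
    linear_combination h4
  rcases mul_eq_zero.1 ha' with h | h
  · obtain rfl : a = 1 := by linarith
    have hX1 : X = 1 := by
      apply mul_left_cancel₀ hX.ne'
      linear_combination h1
    subst hX1
    have hY1 : Y = 1 := by
      apply mul_left_cancel₀ hY.ne'
      linear_combination h2
    subst hY1
    rcases eq_zero_or_one_of_mul hB with rfl | rfl
    · exact ⟨(1, 0, 0, 1, 1, 1), by decide +kernel, by norm_num⟩
    · exact ⟨(1, 1, 1, 1, 1, 1), by decide +kernel, by norm_num⟩
  · obtain rfl : a = 1 / 2 := by linarith
    have := eq_of_two_variable_system hX hY (by linear_combination h1)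
      (by apply mul_right_cancel₀ hY.ne'; linear_combination h2)
    rcases eq_zero_or_one_of_mul hB with rfl | rfl <;> rcases this with ⟨rfl, rfl⟩ | ⟨rfl, rfl⟩
    · exact ⟨(1/2, 0, 0, 1/2, 2, 1), by decide +kernel, by norm_num⟩
    · exact ⟨(1/2, 0, 0, 9/10, 6/5, 1), by decide +kernel, by norm_num⟩
    · exact ⟨(1/2, 1, 1, 1/2, 2, 1), by decide +kernel, by norm_num⟩
    · exact ⟨(1/2, 1, 1, 9/10, 6/5, 1), by decide +kernel, by norm_num⟩

theorem InvariantSystem.isListed {a b c X Y Z : ℝ} (h : InvariantSystem a b c X Y Z) :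
    IsListed a b c X Y Z := by
  by_cases ha : a = 0
  · subst ha
    exact h.isListed_of_a_eq_zero
  obtain ⟨β, rfl⟩ : ∃ β, b = (1 + β) / 2 := ⟨2 * b - 1, by ring⟩
  obtain ⟨γ, rfl⟩ : ∃ γ, c = (1 + γ) / 2 := ⟨2 * c - 1, by ring⟩
  have ⟨hX, hY, hZ, _, _, _, h4, h5, h6⟩ := h
  have e6 : a ^ 2 * (γ - β) * Y + (γ ^ 2 - 1 - a * (β ^ 2 - 1)) / 4 * γ * Z = 0 := by
    linear_combination h6
  have e5 : (γ ^ 2 - 1 - a * (β ^ 2 - 1)) * (γ - a * β) * Y + (β ^ 2 - 1) * β * X = 0 := by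
    apply mul_left_cancel₀ hZ.ne'
    linear_combination 4 * h5 + 4 * Y * e6
  by_cases hγ : γ = 0
  · subst hγ
    have : a ^ 2 * β * Y = 0 := by linear_combination -e6
    have hβ : β = 0 := by simpa [ha, hY.ne'] using this
    subst hβ
    simpa using (show InvariantSystem a (1 / 2) (1 / 2) X Y Z by simpa using h).isListed_of_b_c_eq_half ha
  by_cases hE : γ ^ 2 - 1 - a * (β ^ 2 - 1) = 0
  · have hβγ : γ - β = 0 := by
      have : a ^ 2 * (γ - β) * Y = 0 := by linear_combination e6 - γ * Z / 4 * hE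
      simpa [ha, hY.ne'] using this
    obtain rfl : γ = β := by linarith
    have hB : γ ^ 2 - 1 = 0 := by
      have : (γ ^ 2 - 1) * γ * X = 0 := by
        linear_combination e5 - (γ - a * γ) * Y * hE
      simpa [hγ, hX.ne'] using this
    exact h.isListed_of_b_eq_c ha (by linear_combination hB / 4)
  have hβ : β ≠ 0 := by
    rintro rfl
    have : (γ ^ 2 - 1 - a * (0 ^ 2 - 1)) * (γ * Y) = 0 := by linear_combination e5
    exact mul_ne_zero hE (mul_ne_zero hγ hY.ne') this
  by_cases hB : β ^ 2 - 1 = 0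
  · exfalso
    have hγa : γ - a * β = 0 := by
      have : (γ ^ 2 - 1 - a * (β ^ 2 - 1)) * ((γ - a * β) * Y) = 0 := by
        linear_combination e5 - β * X * hB
      simpa [hE, hY.ne'] using this
    obtain rfl : γ = a * β := by linarith
    have ha1 : a - 1 ≠ 0 := by
      intro h0
      apply hE
      linear_combination (a ^ 2 - a) * hB + (a + 1) * h0
    have f6 : 4 * a * Y + (a + 1) * Z = 0 := by
      apply mul_left_cancel₀ (mul_ne_zero (mul_ne_zero ha hβ) ha1)
      linear_combination 4 * e6 - (a ^ 2 - a) * (a * β) * Z * hB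
    have f4 : 2 * (2 * a - 1) * Y + (a - 1) * Z = 0 := by
      apply mul_left_cancel₀ (mul_ne_zero (mul_ne_zero ha ha1) hY.ne')
      linear_combination 2 * h4 + (-a * (a - 1) ^ 2 * Y * Z
        + ((a * β) ^ 2 - 1 - a * (β ^ 2 - 1)) / 8 * Z ^ 2) * hB
    have : (1 - 3 * a) * Z = 0 := by linear_combination 2 * a * f4 - (2 * a - 1) * f6
    have : 1 - 3 * a = 0 := by simpa [hZ.ne'] using this
    obtain rfl : a = 1 / 3 := by linarith
    linarith
  obtain ⟨t, rfl⟩ : ∃ t, β = t * γ := ⟨β / γ, by field_simp⟩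
  obtain ⟨k, rfl⟩ : ∃ k, Z = k * Y := ⟨Z / Y, by field_simp⟩
  obtain ⟨r, rfl⟩ : ∃ r, Y = r * X := ⟨Y / X, by field_simp⟩
  exact h.isListed_of_generic ha hγ hB (left_ne_zero_of_mul hβ) hE
    (pos_of_mul_pos_left hY hX.le) (pos_of_mul_pos_left hZ hY.le)

/-- The inverse of the passage to invariant coordinates. -/
noncomputable def ofInvariants (q : ℚ × ℚ × ℚ × ℚ × ℚ × ℚ) : ℝ × ℝ × ℝ × ℝ × ℝ × ℝ :=
  (√q.2.2.2.1, √q.2.2.2.2.1, √q.2.2.2.2.2, q.1 * √q.2.2.2.2.1 / √q.2.2.2.1,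
    q.2.2.1 * √q.2.2.2.2.2 / √q.2.2.2.1, q.2.1 * √q.2.2.2.2.2 / √q.2.2.2.2.1)

theorem setOf_criticalPoint_eq_image :
    {p : ℝ × ℝ × ℝ × ℝ × ℝ × ℝ |
        CriticalPoint p.1 p.2.1 p.2.2.1 p.2.2.2.1 p.2.2.2.2.1 p.2.2.2.2.2} =
      ofInvariants '' (invariantSolutions : Set (ℚ × ℚ × ℚ × ℚ × ℚ × ℚ)) := by
  ext ⟨x, y, z, u, v, w⟩
  simp only [Set.mem_ofPred_eq, Set.mem_image, Finset.mem_coe]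
  constructor
  · intro h
    have hx := h.1
    have hy := h.2.1
    have hz := h.2.2.1
    obtain ⟨q, hq, ha, hb, hc, hX, hY, hZ⟩ := ((criticalPoint_iff hx hy hz).1 h).isListed
    refine ⟨q, hq, ?_⟩
    simp only [ofInvariants, ← ha, ← hb, ← hc, ← hX, ← hY, ← hZ, Real.sqrt_sq hx.le,
      Real.sqrt_sq hy.le, Real.sqrt_sq hz.le, Prod.mk.injEq, true_and]
    refine ⟨?_, ?_, ?_⟩ <;> field_simp
  · rintro ⟨⟨a, b, c, X, Y, Z⟩, hq, h⟩
    simp only [ofInvariants, Prod.mk.injEq] at h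
    obtain ⟨rfl, rfl, rfl, rfl, rfl, rfl⟩ := h
    have hs := invariantSystem_of_mem hq
    have hX := Real.sqrt_pos.2 hs.posX
    have hY := Real.sqrt_pos.2 hs.posY
    have hZ := Real.sqrt_pos.2 hs.posZ
    rw [criticalPoint_iff hX hY hZ, Real.sq_sqrt hs.posX.le, Real.sq_sqrt hs.posY.le,
      Real.sq_sqrt hs.posZ.le]
    convert hs using 1 <;> field_simp

theorem injOn_ofInvariants :
    Set.InjOn ofInvariants (invariantSolutions : Set (ℚ × ℚ × ℚ × ℚ × ℚ × ℚ)) := by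
  rintro ⟨a, b, c, X, Y, Z⟩ hq ⟨a', b', c', X', Y', Z'⟩ hq' h
  have hs := invariantSystem_of_mem hq
  have hs' := invariantSystem_of_mem hq'
  have hX := (Real.sqrt_pos.2 hs.posX).ne'
  have hY := (Real.sqrt_pos.2 hs.posY).ne'
  have hZ := (Real.sqrt_pos.2 hs.posZ).ne'
  simp only [ofInvariants, Prod.mk.injEq] at h hX hY hZ
  obtain ⟨h1, h2, h3, h4, h5, h6⟩ := h
  rw [← h1, ← h2, div_left_inj' hX, mul_left_inj' hY] at h4
  rw [← h1, ← h3, div_left_inj' hX, mul_left_inj' hZ] at h5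
  rw [← h2, ← h3, div_left_inj' hY, mul_left_inj' hZ] at h6
  rw [Real.sqrt_inj hs.posX.le hs'.posX.le] at h1
  rw [Real.sqrt_inj hs.posY.le hs'.posY.le] at h2
  rw [Real.sqrt_inj hs.posZ.le hs'.posZ.le] at h3
  simp only [Prod.mk.injEq]
  exact ⟨by exact_mod_cast h4, by exact_mod_cast h6, by exact_mod_cast h5, by exact_mod_cast h1,
    by exact_mod_cast h2, by exact_mod_cast h3⟩

/-- The solution set of the critical point system has exactly 29 elements. -/
theorem stmt_11 :
    {p : ℝ × ℝ × ℝ × ℝ × ℝ × ℝ |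
        CriticalPoint p.1 p.2.1 p.2.2.1 p.2.2.2.1 p.2.2.2.2.1 p.2.2.2.2.2}.ncard = 29 := by
  rw [setOf_criticalPoint_eq_image, injOn_ofInvariants.ncard_image,
    Set.ncard_coe_finset, card_invariantSolutions]
end

section
/- For every integer n ≥ 1, the number p(n) of integer partitions of n satisfies p(n) > (1/(13n))·exp((5/2)·√n). -/
open Finset

theorem card_partition_le_card_filter_count (n i k : ℕ) (hk : 0 < k) (h : i * k ≤ n) :
    Fintype.card (Nat.Partition (n - i * k)) ≤
      #{q : Nat.Partition n | i ≤ q.parts.count k} := by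
  rw [← Finset.card_univ]
  refine Finset.card_le_card_of_injOn
    (fun q => ⟨q.parts + Multiset.replicate i k, ?_, ?_⟩) ?_ ?_
  · intro j hj
    rcases Multiset.mem_add.1 hj with hj | hj
    · exact q.parts_pos hj
    · rwa [Multiset.eq_of_mem_replicate hj]
  · rw [Multiset.sum_add, q.parts_sum, Multiset.sum_replicate, smul_eq_mul]
    omega
  · intro q _
    simp
  · intro q _ r _ hqr
    simpa [Nat.Partition.ext_iff] using hqr

theorem sum_mul_card_partition_le (n : ℕ) :
    ∑ k ∈ Icc 1 n, ∑ i ∈ Icc 1 n,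
      (if i * k ≤ n then k * Fintype.card (Nat.Partition (n - i * k)) else 0) ≤
        n * Fintype.card (Nat.Partition n) := by
  have hsum : ∀ q : Nat.Partition n, ∑ k ∈ Icc 1 n, q.parts.count k * k = n := by
    intro q
    conv_rhs => rw [← q.parts_sum]
    rw [Finset.sum_multiset_count_of_subset q.parts (Icc 1 n)]
    · simp
    · intro k hk
      rw [Multiset.mem_toFinset] at hk
      exact Finset.mem_Icc.2 ⟨q.parts_pos hk, q.le_of_mem_parts hk⟩
  have hcount : ∀ (c : ℕ), ∑ i ∈ Icc 1 n, (if i ≤ c then 1 else 0) ≤ c := by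
    intro c
    rw [← Finset.card_filter]
    calc _ ≤ #(Icc 1 c) := Finset.card_le_card fun i => by simp; omega
      _ = c := by simp
  calc _ ≤ ∑ k ∈ Icc 1 n, ∑ i ∈ Icc 1 n,
        k * #{q : Nat.Partition n | i ≤ q.parts.count k} := by
        refine Finset.sum_le_sum fun k hk => Finset.sum_le_sum fun i _ => ?_
        split_ifs with h
        · exact Nat.mul_le_mul_left _
            (card_partition_le_card_filter_count n i k (Finset.mem_Icc.1 hk).1 h)
        · exact Nat.zero_le _
    _ = ∑ q : Nat.Partition n, ∑ k ∈ Icc 1 n,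
          (∑ i ∈ Icc 1 n, if i ≤ q.parts.count k then 1 else 0) * k := by
        rw [Finset.sum_comm (s := univ)]
        refine Finset.sum_congr rfl fun k _ => ?_
        simp only [Finset.card_filter, ← Finset.mul_sum, ← Finset.sum_mul]
        rw [Finset.sum_comm, mul_comm]
    _ ≤ ∑ q : Nat.Partition n, ∑ k ∈ Icc 1 n, q.parts.count k * k :=
        Finset.sum_le_sum fun q _ => Finset.sum_le_sum fun k _ =>
          Nat.mul_le_mul_right _ (hcount _)
    _ = n * Fintype.card (Nat.Partition n) := by
        rw [Finset.sum_congr rfl fun q _ => hsum q]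
        simp [mul_comm]

theorem sum_sum_divisors_mul_card_partition_le (n : ℕ) :
    ∑ j ∈ Icc 1 n, (∑ k ∈ j.divisors, k) * Fintype.card (Nat.Partition (n - j)) ≤
      n * Fintype.card (Nat.Partition n) := by
  refine le_trans ?_ (sum_mul_card_partition_le n)
  have key : ∀ k ∈ Icc 1 n, ∀ i ∈ Icc 1 n,
      (if i * k ≤ n then k * Fintype.card (Nat.Partition (n - i * k)) else 0) =
        ∑ j ∈ Icc 1 n, if i * k = j then k * Fintype.card (Nat.Partition (n - j)) else 0 := by
    intro k hk i hi
    rw [Finset.sum_ite_eq]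
    have : 0 < i * k := Nat.mul_pos (Finset.mem_Icc.1 hi).1 (Finset.mem_Icc.1 hk).1
    simp [Nat.one_le_iff_ne_zero, this.ne']
  rw [Finset.sum_congr rfl fun k hk => Finset.sum_congr rfl (key k hk),
    Finset.sum_congr rfl fun k _ => Finset.sum_comm, Finset.sum_comm]
  refine Finset.sum_le_sum fun j hj => ?_
  rw [Finset.mem_Icc] at hj
  have hsub : j.divisors ⊆ Icc 1 n := fun k hk =>
    Finset.mem_Icc.2 ⟨Nat.pos_of_mem_divisors hk, (Nat.divisor_le hk).trans hj.2⟩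
  rw [Finset.sum_mul]
  refine (Finset.sum_le_sum fun k hk => ?_).trans (Finset.sum_le_sum_of_subset hsub)
  obtain ⟨i, rfl⟩ := Nat.dvd_of_mem_divisors hk
  have hi : i ∈ Icc 1 n := Finset.mem_Icc.2
    ⟨Nat.pos_of_mul_pos_left hj.1, (Nat.le_mul_of_pos_left i (Nat.pos_of_mem_divisors hk)).trans hj.2⟩
  refine le_trans ?_ (Finset.single_le_sum
    (f := fun i' => if i' * k = k * i then k * Fintype.card (Nat.Partition (n - k * i)) else 0)
    (fun _ _ => Nat.zero_le _) hi)
  simp [mul_comm]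

/-- The sum of the products of the corresponding entries of two lists. -/
def sumMul : List ℕ → List ℕ → ℕ
  | x :: l, y :: S => x * y + sumMul l S
  | _, _ => 0

/-- Lower bounds for the numbers of partitions of `n, n - 1, …, 0`, obtained from the recursion
`∑ σ(j) p(n - j) ≤ n p(n)`, where `S` lists lower bounds for `σ(1), σ(2), …`. -/
def partitionLowerBounds (S : List ℕ) : ℕ → List ℕ
  | 0 => [1]
  | n + 1 => sumMul (partitionLowerBounds S n) S / (n + 1) ::
      partitionLowerBounds S n

theorem length_partitionLowerBounds (S : List ℕ) (n : ℕ) :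
    (partitionLowerBounds S n).length = n + 1 := by
  induction n with
  | zero => rfl
  | succ n ih => simp [partitionLowerBounds, ih]

theorem sumMul_le (l S : List ℕ) (a b : ℕ → ℕ) (hl : ∀ j, l.getD j 0 ≤ a j)
    (hS : ∀ j, S.getD j 0 ≤ b j) :
    sumMul l S ≤ ∑ j ∈ range l.length, a j * b j := by
  induction l generalizing S a b with
  | nil => simp [sumMul]
  | cons x l ih =>
    cases S with
    | nil => simp [sumMul]
    | cons y S =>
      rw [List.length_cons, Finset.sum_range_succ', sumMul, add_comm]
      refine add_le_add (ih S _ _ (fun j => ?_) fun j => ?_) (Nat.mul_le_mul ?_ ?_)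
      · simpa using hl (j + 1)
      · simpa using hS (j + 1)
      · simpa using hl 0
      · simpa using hS 0

theorem partitionLowerBounds_getD_le (S : List ℕ)
    (hS : ∀ j, S.getD j 0 ≤ ∑ k ∈ (j + 1).divisors, k) (n j : ℕ) :
    (partitionLowerBounds S n).getD j 0 ≤ Fintype.card (Nat.Partition (n - j)) := by
  induction n generalizing j with
  | zero =>
    cases j with
    | zero => simp [partitionLowerBounds]
    | succ j => simp [partitionLowerBounds]
  | succ n ih =>
    cases j with
    | zero =>
      simp only [partitionLowerBounds, List.getD_cons_zero, Nat.sub_zero]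
      refine Nat.div_le_of_le_mul ((sumMul_le _ _ _ _ ih hS).trans ?_)
      refine le_trans (le_of_eq ?_) (sum_sum_divisors_mul_card_partition_le (n + 1))
      rw [length_partitionLowerBounds, ← Finset.Ico_add_one_right_eq_Icc,
        Finset.sum_Ico_eq_sum_range]
      refine Finset.sum_congr rfl fun j _ => ?_
      rw [Nat.add_comm 1 j, Nat.add_sub_add_right, mul_comm]
    | succ j => simpa [partitionLowerBounds] using ih j

/-- Newton's iteration for the square root of `m`, rounded so as to approach it from above. -/
def sqrtUpper (m : ℕ) : ℕ → ℕ
  | 0 => 1000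
  | i + 1 => (sqrtUpper m i + m / sqrtUpper m i) / 2 + 1

/-- A sufficient numerical condition for `exp (5 / 2 * √n) < 13 * n * P`. -/
def expSqrtCheck (n P : ℕ) : Bool :=
  15625 * n ≤ sqrtUpper (15625 * n) 6 ^ 2 &&
    27182818286 ^ sqrtUpper (15625 * n) 6 <
      (13 * n * P) ^ 50 * 10000000000 ^ sqrtUpper (15625 * n) 6

theorem exp_sqrt_lt_of_expSqrtCheck {n P : ℕ} (h : expSqrtCheck n P = true) :
    Real.exp (5 / 2 * √n) < 13 * n * P := by
  rw [expSqrtCheck, Bool.and_eq_true, decide_eq_true_iff, decide_eq_true_iff] at h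
  generalize sqrtUpper (15625 * n) 6 = r at h
  obtain ⟨h₁, h₂⟩ := h
  have h₁' : (15625 * n : ℝ) ≤ r ^ 2 := by exact_mod_cast h₁
  have h₂' : (27182818286 : ℝ) ^ r < (13 * n * P) ^ 50 * 10000000000 ^ r := by exact_mod_cast h₂
  have hr : 5 / 2 * √n * 50 ≤ r := by
    refine abs_le_of_sq_le_sq' ?_ (Nat.cast_nonneg r) |>.2
    nlinarith [Real.sq_sqrt (Nat.cast_nonneg (α := ℝ) n)]
  refine lt_of_pow_lt_pow_left₀ 50 (by positivity) ?_
  calc Real.exp (5 / 2 * √n) ^ 50 = Real.exp (5 / 2 * √n * 50) := by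
        rw [← Real.exp_nat_mul]; congr 1; push_cast; ring
    _ ≤ Real.exp r := Real.exp_le_exp.2 hr
    _ = Real.exp 1 ^ r := by rw [← Real.exp_nat_mul, mul_one]
    _ ≤ (2.7182818286 : ℝ) ^ r := pow_le_pow_left₀ (Real.exp_pos 1).le Real.exp_one_lt_d9.le r
    _ < (13 * n * P) ^ 50 := by
        rw [show (2.7182818286 : ℝ) = 27182818286 / 10000000000 by norm_num, div_pow]
        rwa [div_lt_iff₀ (by positivity)]

/-- `expSqrtCheck` for `n, n - 1, …, 1` and the successive entries of a list. -/
def expSqrtCheckAll : ℕ → List ℕ → Bool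
  | n + 1, P :: l => expSqrtCheck (n + 1) P && expSqrtCheckAll n l
  | _, _ => true

theorem expSqrtCheck_of_expSqrtCheckAll {n : ℕ} {l : List ℕ} (h : expSqrtCheckAll n l = true)
    {j : ℕ} (hj : j < n) (hjl : j < l.length) : expSqrtCheck (n - j) (l.getD j 0) = true := by
  induction l generalizing n j with
  | nil => simp at hjl
  | cons P l ih =>
    cases n with
    | zero => omega
    | succ n =>
      rw [expSqrtCheckAll, Bool.and_eq_true] at h
      cases j with
      | zero => exact h.1
      | succ j =>
        rw [Nat.add_sub_add_right, List.getD_cons_succ]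
        exact ih h.2 (by omega) (by simpa using hjl)

/-- The sum of the divisors of `n` that are at most `k`. -/
def sumDivisorsUpTo (n : ℕ) : ℕ → ℕ
  | 0 => 0
  | k + 1 => (bif Nat.beq (n % (k + 1)) 0 then k + 1 else 0) + sumDivisorsUpTo n k

theorem sumDivisorsUpTo_eq (n k : ℕ) :
    sumDivisorsUpTo n k = ∑ d ∈ Ico 1 (k + 1), if d ∣ n then d else 0 := by
  induction k with
  | zero => rfl
  | succ k ih =>
    rw [Finset.sum_Ico_succ_top (by omega), sumDivisorsUpTo, ih, add_comm, Bool.cond_eq_ite]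
    simp only [Nat.beq_eq, Nat.dvd_iff_mod_eq_zero]

/-- The values `σ(1), …, σ(N)` of the sum-of-divisors function. -/
def sumDivisorsList (N : ℕ) : List ℕ :=
  (List.range N).map fun j => sumDivisorsUpTo (j + 1) (j + 1)

theorem sumDivisorsList_getD_le (N j : ℕ) :
    (sumDivisorsList N).getD j 0 ≤ ∑ k ∈ (j + 1).divisors, k := by
  rw [sumDivisorsList, Nat.divisors, Finset.sum_filter, ← sumDivisorsUpTo_eq]
  rcases lt_or_ge j N with hj | hj
  · simp [List.getD_eq_getElem?_getD, hj]
  · simp [List.getD_eq_getElem?_getD, hj]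

set_option maxRecDepth 100000 in
theorem expSqrtCheckAll_partitionLowerBounds :
    expSqrtCheckAll 483 (partitionLowerBounds (sumDivisorsList 483) 483) = true := by
  decide +kernel

theorem exp_sqrt_lt_card_partition_of_le {n : ℕ} (h₁ : 1 ≤ n) (h₂ : n ≤ 483) :
    Real.exp (5 / 2 * √n) < 13 * n * Fintype.card (Nat.Partition n) := by
  have hn : 483 - (483 - n) = n := by omega
  have h := expSqrtCheck_of_expSqrtCheckAll expSqrtCheckAll_partitionLowerBounds
    (j := 483 - n) (by omega) (by rw [length_partitionLowerBounds]; omega)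
  have hle := partitionLowerBounds_getD_le _ (sumDivisorsList_getD_le 483) 483 (483 - n)
  rw [hn] at h hle
  refine (exp_sqrt_lt_of_expSqrtCheck h).trans_le ?_
  gcongr

theorem hasSum_pow_mul_geometric {y : ℝ} (hy : |y| < 1) :
    HasSum (fun m : ℕ => (m : ℝ) * y ^ m) (y / (1 - y) ^ 2) ∧
    HasSum (fun m : ℕ => (m : ℝ) ^ 2 * y ^ m) (y * (1 + y) / (1 - y) ^ 3) ∧
    HasSum (fun m : ℕ => (m : ℝ) ^ 3 * y ^ m) (y * (1 + 4 * y + y ^ 2) / (1 - y) ^ 4) ∧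
    HasSum (fun m : ℕ => (m : ℝ) ^ 4 * y ^ m)
      (y * (1 + y) * (1 + 10 * y + y ^ 2) / (1 - y) ^ 5) := by
  have hy1 : 1 - y ≠ 0 := by have := (abs_lt.1 hy).2; linarith
  have H (k : ℕ) := hasSum_choose_mul_geometric_of_norm_lt_one k (r := y) hy
  have hc (m k : ℕ) : ((m : ℝ) + k + 1) * ((m + k).choose k : ℝ) =
      ((m + (k + 1)).choose (k + 1) : ℝ) * (k + 1) := by
    exact_mod_cast Nat.add_one_mul_choose_eq (m + k) k
  have c0 (m : ℕ) : ((m + 0).choose 0 : ℝ) = 1 := by simp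
  have c1 (m : ℕ) : ((m + 1).choose 1 : ℝ) = m + 1 := by simp
  have c2 (m : ℕ) : ((m + 2).choose 2 : ℝ) = (m + 1) * (m + 2) / 2 := by
    have := hc m 1
    rw [c1] at this
    push_cast at this
    linear_combination -this / 2
  have c3 (m : ℕ) : ((m + 3).choose 3 : ℝ) = (m + 1) * (m + 2) * (m + 3) / 6 := by
    have := hc m 2
    rw [c2] at this
    push_cast at this
    linear_combination -this / 3
  have c4 (m : ℕ) : ((m + 4).choose 4 : ℝ) = (m + 1) * (m + 2) * (m + 3) * (m + 4) / 24 := by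
    have := hc m 3
    rw [c3] at this
    push_cast at this
    linear_combination -this / 4
  have H0 := H 0
  have H1 := H 1
  have H2 := H 2
  have H3 := H 3
  have H4 := H 4
  simp only [c0, c1, c2, c3, c4] at H0 H1 H2 H3 H4
  refine ⟨?_, ?_, ?_, ?_⟩
  · convert! H1.sub H0 using 1
    · ext m; ring
    · field_simp; ring
  · convert! ((H2.mul_left 2).sub (H1.mul_left 3)).add H0 using 1
    · ext m; ring
    · field_simp; ring
  · convert! (((H3.mul_left 6).sub (H2.mul_left 12)).add (H1.mul_left 7)).sub H0 using 1
    · ext m; ring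
    · field_simp; ring
  · convert! ((((H4.mul_left 24).sub (H3.mul_left 60)).add (H2.mul_left 50)).sub
      (H1.mul_left 15)).add H0 using 1
    · ext m; ring
    · field_simp; ring

/-- The bounds `2 / w ≤ coth (w / 2)` and `coth (w / 2) ^ 2 ≤ 1 + (2 / w) ^ 2`, with the hyperbolic
cotangent expressed through `exp (-w)`. -/
theorem coth_half_bounds {w : ℝ} (hw : 0 < w) :
    2 / w ≤ (1 + Real.exp (-w)) / (1 - Real.exp (-w)) ∧
      ((1 + Real.exp (-w)) / (1 - Real.exp (-w))) ^ 2 ≤ 1 + (2 / w) ^ 2 := by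
  have hs : w / 2 ≤ Real.sinh (w / 2) := Real.self_le_sinh_iff.2 (by linarith)
  have ht : Real.sinh (w / 2) ≤ w / 2 * Real.cosh (w / 2) := by
    have hmono : MonotoneOn (fun x => x * Real.cosh x - Real.sinh x) (Set.Ici 0) := by
      refine monotoneOn_of_deriv_nonneg (convex_Ici 0) (by fun_prop) (by fun_prop) fun x hx => ?_
      rw [interior_Ici, Set.mem_Ioi] at hx
      have hd : HasDerivAt (fun x => x * Real.cosh x - Real.sinh x)
          (1 * Real.cosh x + x * Real.sinh x - Real.cosh x) x :=
        ((hasDerivAt_id x).mul (Real.hasDerivAt_cosh x)).sub (Real.hasDerivAt_sinh x)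
      rw [hd.deriv]
      nlinarith [mul_nonneg hx.le (Real.sinh_nonneg_iff.2 hx.le)]
    have := hmono (Set.mem_Ici.2 le_rfl) (Set.mem_Ici.2 (by linarith : 0 ≤ w / 2)) (by linarith)
    simp at this
    linarith
  have hsp : 0 < Real.sinh (w / 2) := by linarith
  have hQ : (1 + Real.exp (-w)) / (1 - Real.exp (-w)) =
      Real.cosh (w / 2) / Real.sinh (w / 2) := by
    have h1 : Real.exp (-w) = Real.exp (-(w / 2)) * Real.exp (-(w / 2)) := by
      rw [← Real.exp_add]; ring_nf
    have h2 : Real.exp (w / 2) * Real.exp (-(w / 2)) = 1 := by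
      rw [← Real.exp_add]; simp
    have h3 : Real.exp (-w) < 1 := by simpa using hw
    rw [div_eq_div_iff (by linarith) hsp.ne', Real.cosh_eq, Real.sinh_eq, h1]
    linear_combination Real.exp (-(w / 2)) * h2
  rw [hQ]
  constructor
  · rw [div_le_div_iff₀ hw hsp]
    linarith
  · rw [div_pow, Real.cosh_sq, add_div, div_self (by positivity)]
    rw [one_div, ← inv_div w 2, inv_pow]
    gcongr

/-- The exponentially damped cubic minorant of `n * p(n - x) / p(n)`, with `R = √n`. -/
noncomputable def minorant (R x : ℝ) : ℝ :=
  Real.exp (-(5 / (4 * R)) * x) *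
    (1 + x / R ^ 2 - 5 / 2 * R * ((x / R ^ 2) ^ 2 / 8 + 3 * (x / R ^ 2) ^ 3 / 8))

theorem minorant_nonpos {R x : ℝ} (hR : 2 ≤ R) (hx : R ^ 2 ≤ x) : minorant R x ≤ 0 := by
  refine mul_nonpos_of_nonneg_of_nonpos (Real.exp_pos _).le ?_
  have hu : 1 ≤ x / R ^ 2 := (one_le_div (by positivity)).2 hx
  generalize x / R ^ 2 = u at hu
  have h2 : 1 ≤ u ^ 2 := by nlinarith
  have h3 : u ≤ u ^ 3 := by nlinarith
  nlinarith [mul_le_mul_of_nonneg_right hR (by positivity : 0 ≤ u ^ 2 / 8 + 3 * u ^ 3 / 8)]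

theorem mul_minorant_le {R x : ℝ} (hR : 0 < R) (hx0 : 0 ≤ x) (hx : x < R ^ 2) :
    Real.exp (5 / 2 * R) / R ^ 2 * minorant R x ≤
      Real.exp (5 / 2 * √(R ^ 2 - x)) / (R ^ 2 - x) := by
  obtain ⟨u, rfl⟩ : ∃ u, x = R ^ 2 * u := ⟨x / R ^ 2, by field_simp⟩
  have hR2 : 0 < R ^ 2 := by positivity
  have hu0 : 0 ≤ u := nonneg_of_mul_nonneg_right hx0 hR2
  have hu1 : u < 1 := by nlinarith
  have hsqrt : R * (1 - u / 2 - (u ^ 2 / 8 + 3 * u ^ 3 / 8)) ≤ √(R ^ 2 - R ^ 2 * u) := by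
    rw [show R ^ 2 - R ^ 2 * u = R ^ 2 * (1 - u) by ring, Real.sqrt_mul hR2.le,
      Real.sqrt_sq hR.le]
    refine mul_le_mul_of_nonneg_left (Real.le_sqrt_of_sq_le ?_) hR.le
    have : 0 ≤ u ^ 3 * (1 - u) * (40 + 15 * u + 9 * u ^ 2) := by
      have := sub_pos.2 hu1
      positivity
    nlinarith
  have hinv : Real.exp u ≤ 1 / (1 - u) := by
    rw [le_div_iff₀ (by linarith)]
    have := Real.one_sub_le_exp_neg u
    calc _ ≤ Real.exp u * Real.exp (-u) := by gcongr
      _ = 1 := by rw [← Real.exp_add]; simp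
  have hm : minorant R (R ^ 2 * u) ≤
      Real.exp (-(5 / 4 * R * u)) * Real.exp (u - 5 / 2 * R * (u ^ 2 / 8 + 3 * u ^ 3 / 8)) := by
    rw [minorant, mul_div_cancel_left₀ u hR2.ne']
    rw [show -(5 / (4 * R)) * (R ^ 2 * u) = -(5 / 4 * R * u) by field_simp]
    gcongr
    linarith [Real.add_one_le_exp (u - 5 / 2 * R * (u ^ 2 / 8 + 3 * u ^ 3 / 8))]
  calc _ ≤ Real.exp (5 / 2 * R) / R ^ 2 * (Real.exp (-(5 / 4 * R * u)) *
          Real.exp (u - 5 / 2 * R * (u ^ 2 / 8 + 3 * u ^ 3 / 8))) := by gcongr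
    _ = Real.exp (5 / 2 * (R * (1 - u / 2 - (u ^ 2 / 8 + 3 * u ^ 3 / 8)))) *
          Real.exp u / R ^ 2 := by
        rw [div_mul_eq_mul_div, ← Real.exp_add, ← Real.exp_add, ← Real.exp_add]
        ring_nf
    _ ≤ Real.exp (5 / 2 * √(R ^ 2 - R ^ 2 * u)) * (1 / (1 - u)) / R ^ 2 := by gcongr
    _ = _ := by
        have : 1 - u ≠ 0 := by linarith
        rw [show R ^ 2 - R ^ 2 * u = R ^ 2 * (1 - u) by ring]
        field_simp

theorem le_of_coth_bounds {z Q : ℝ} {a b c : ℝ} (hz : 0 ≤ z) (ha : 0 ≤ a) (hb : 0 ≤ b)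
    (hc : 0 ≤ c) (h1 : 2 * z ≤ Q) (h2 : Q ^ 2 ≤ 1 + (2 * z) ^ 2) (h3 : 1 ≤ Q) :
    z ^ 2 - 1 / 4 + a * (2 * z ^ 3 - z / 2) - b * (z ^ 2 + 6 * z ^ 4) -
      c * (24 * z ^ 5 + 12 * z ^ 4 + 2 * z ^ 3 + z ^ 2) ≤
    (Q ^ 2 - 1) / 4 + a * ((Q ^ 2 - 1) / 4 * Q) - b * ((Q ^ 2 - 1) / 4 * (1 + 6 * ((Q ^ 2 - 1) / 4)))
      - c * ((Q ^ 2 - 1) / 4 * Q * (1 + 12 * ((Q ^ 2 - 1) / 4))) := by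
  have hQ : Q ≤ 1 + 2 * z := by nlinarith
  obtain ⟨A, hA⟩ : ∃ A, A = (Q ^ 2 - 1) / 4 := ⟨_, rfl⟩
  rw [← hA]
  have hA0 : 0 ≤ A := by rw [hA]; nlinarith
  have hA1 : A ≤ z ^ 2 := by rw [hA]; linarith
  have hA2 : z ^ 2 - 1 / 4 ≤ A := by rw [hA]; nlinarith
  have e2 : 2 * z ^ 3 - z / 2 ≤ A * Q := by nlinarith
  have e3 : A * (1 + 6 * A) ≤ z ^ 2 * (1 + 6 * z ^ 2) := by gcongr
  have e4 : A * Q * (1 + 12 * A) ≤ z ^ 2 * (1 + 2 * z) * (1 + 12 * z ^ 2) := by gcongr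
  have f2 := mul_le_mul_of_nonneg_left e2 ha
  have f3 := mul_le_mul_of_nonneg_left e3 hb
  have f4 := mul_le_mul_of_nonneg_left e4 hc
  nlinarith

theorem le_sum_mul_minorant {R : ℝ} (hR : 2 ≤ R) {n i : ℕ} (hn : (n : ℝ) = R ^ 2) (hi : 1 ≤ i) :
    (16 * R ^ 2 / 25 + 32 * R / 125 - 4608 / 625) / i ^ 2 - 1 / 4 - 3 / (5 * R) -
        576 / (125 * i * R) - 24 / (25 * R ^ 2) - 3 * i / (5 * R ^ 3) ≤
      ∑ k ∈ Icc 1 n, (k : ℝ) * minorant R (i * k) := by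
  have hR0 : 0 < R := by linarith
  have hi0 : (0 : ℝ) < i := by exact_mod_cast hi
  obtain ⟨w, hw⟩ : ∃ w, w = 5 / (4 * R) * i := ⟨_, rfl⟩
  have hw0 : 0 < w := by rw [hw]; positivity
  have hy0 := Real.exp_pos (-w)
  have hy1 : Real.exp (-w) < 1 := by simpa using hw0
  obtain ⟨y, hy⟩ : ∃ y, y = Real.exp (-w) := ⟨_, rfl⟩
  obtain ⟨s1, s2, s3, s4⟩ := hasSum_pow_mul_geometric (y := y) (by rw [hy, abs_of_pos hy0]; exact hy1)
  obtain ⟨q1, q2⟩ := coth_half_bounds hw0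
  rw [← hy] at q1 q2 hy0 hy1
  have hy1' : 1 - y ≠ 0 := by linarith
  have q3 : 1 ≤ (1 + y) / (1 - y) := by rw [one_le_div (by linarith)]; linarith
  have hz : 2 / w = 2 * (4 * R / (5 * i)) := by rw [hw]; field_simp
  rw [hz] at q1 q2
  have key := le_of_coth_bounds (a := i / R ^ 2) (b := 5 / 16 * i ^ 2 / R ^ 3)
    (c := 15 / 16 * i ^ 3 / R ^ 5) (by positivity) (by positivity) (by positivity) (by positivity)
    q1 q2 q3
  have hs : HasSum (fun k : ℕ => (k : ℝ) * minorant R (i * k))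
      (y / (1 - y) ^ 2 + i / R ^ 2 * (y * (1 + y) / (1 - y) ^ 3) -
        5 / 16 * i ^ 2 / R ^ 3 * (y * (1 + 4 * y + y ^ 2) / (1 - y) ^ 4) -
        15 / 16 * i ^ 3 / R ^ 5 * (y * (1 + y) * (1 + 10 * y + y ^ 2) / (1 - y) ^ 5)) := by
    convert! ((s1.add (s2.mul_left _)).sub (s3.mul_left _)).sub (s4.mul_left _) using 1
    ext k
    have : Real.exp (-(5 / (4 * R)) * (i * k)) = y ^ k := by
      rw [hy, ← Real.exp_nat_mul, hw]; ring_nf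
    rw [minorant, this]
    field_simp
    ring
  have hle := sum_le_hasSum (Icc 1 n) (fun k hk => ?_) hs.neg
  · rw [Finset.sum_neg_distrib] at hle
    refine le_trans (le_trans (le_of_eq ?_) key) (le_trans (le_of_eq ?_) (neg_le_neg_iff.1 hle))
    · field_simp
      ring
    · field_simp
      ring
  · rcases Nat.eq_zero_or_pos k with rfl | hk0
    · simp
    · have hkn : (n : ℝ) ≤ k := by
        rw [Finset.mem_Icc] at hk
        exact_mod_cast (by omega : n ≤ k)
      have hi1 : (1 : ℝ) ≤ i := by exact_mod_cast hi
      refine neg_nonneg.2 (mul_nonpos_of_nonneg_of_nonpos (Nat.cast_nonneg k)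
        (minorant_nonpos hR ?_))
      nlinarith

theorem sq_lt_sum_bound {R : ℝ} (hR : 22 ≤ R) :
    R ^ 2 < ∑ i ∈ Icc 1 20, ((16 * R ^ 2 / 25 + 32 * R / 125 - 4608 / 625) / (i : ℕ) ^ 2 - 1 / 4 -
      3 / (5 * R) - 576 / (125 * i * R) - 24 / (25 * R ^ 2) - 3 * i / (5 * R ^ 3)) := by
  have hR0 : 0 < R := by linarith
  have hv : 1 / R ≤ 1 / 22 := one_div_le_one_div_of_le (by norm_num) hR
  have hv0 : 0 < 1 / R := by positivity
  obtain ⟨v, hvR⟩ : ∃ v, v = 1 / R := ⟨_, rfl⟩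
  have h1 (i : ℕ) : (16 * R ^ 2 / 25 + 32 * R / 125 - 4608 / 625) / (i : ℝ) ^ 2 - 1 / 4 -
      3 / (5 * R) - 576 / (125 * i * R) - 24 / (25 * R ^ 2) - 3 * i / (5 * R ^ 3) =
      (16 * R ^ 2 / 25 + 32 * R / 125 - 4608 / 625) * (1 / (i : ℝ) ^ 2) - 1 / 4 - 3 / 5 * v -
      576 / 125 * v * (1 / i) - 24 / 25 * v ^ 2 - 3 / 5 * v ^ 3 * i := by
    rw [hvR]
    rcases Nat.eq_zero_or_pos i with rfl | hi
    · simp; field_simp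
    · field_simp
  have hH2 : (1596 / 1000 : ℝ) ≤ ∑ i ∈ Icc 1 20, 1 / ((i : ℕ) : ℝ) ^ 2 := by
    norm_num [Finset.sum_Icc_succ_top]
  have hH1 : ∑ i ∈ Icc 1 20, 1 / ((i : ℕ) : ℝ) ≤ 36 / 10 := by
    norm_num [Finset.sum_Icc_succ_top]
  have hS : ∑ i ∈ Icc 1 20, ((i : ℕ) : ℝ) = 210 := by
    norm_num [Finset.sum_Icc_succ_top]
  simp only [h1, Finset.sum_sub_distrib, ← Finset.mul_sum, hS, Finset.sum_const, Nat.card_Icc]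
  rw [← hvR] at hv hv0
  have hpos : 0 ≤ 16 * R ^ 2 / 25 + 32 * R / 125 - 4608 / 625 := by nlinarith
  have g1 := mul_le_mul_of_nonneg_left hH2 hpos
  have g2 := mul_le_mul_of_nonneg_left hH1 (by positivity : 0 ≤ 576 / 125 * v)
  have hv2 : v ^ 2 ≤ v / 22 := by nlinarith
  have hv3 : v ^ 3 ≤ v / 484 := by nlinarith
  simp only [one_div] at g1 g2 ⊢
  norm_num
  nlinarith

theorem exp_sqrt_lt_card_partition_of_forall_lt {n : ℕ} (hn : 484 ≤ n)
    (ih : ∀ m < n, 1 ≤ m →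
      1 / (13 * (m : ℝ)) * Real.exp (5 / 2 * √m) < Fintype.card (Nat.Partition m)) :
    1 / (13 * (n : ℝ)) * Real.exp (5 / 2 * √n) < Fintype.card (Nat.Partition n) := by
  obtain ⟨R, hR⟩ : ∃ R, R = √(n : ℝ) := ⟨_, rfl⟩
  have hnR : (n : ℝ) = R ^ 2 := by rw [hR, Real.sq_sqrt (Nat.cast_nonneg n)]
  have hR22 : 22 ≤ R := by
    rw [hR]
    refine Real.le_sqrt_of_sq_le ?_
    norm_num
    exact_mod_cast hn
  rw [← hR, hnR]
  have hR2 : 0 < R ^ 2 := by positivity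
  have hterm : ∀ k ∈ Icc 1 n, ∀ i ∈ Icc (1 : ℕ) 20,
      1 / (13 * R ^ 2) * Real.exp (5 / 2 * R) * ((k : ℝ) * minorant R (i * k)) ≤
        ((if i * k ≤ n then k * Fintype.card (Nat.Partition (n - i * k)) else 0 : ℕ) : ℝ) := by
    intro k hk i hi
    rcases lt_or_ge (i * k) n with h | h
    · rw [if_pos h.le]
      have hsub : ((n - i * k : ℕ) : ℝ) = R ^ 2 - i * k := by
        rw [Nat.cast_sub h.le, hnR]
        push_cast
        rfl
      have hlt : (i * k : ℝ) < R ^ 2 := by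
        rw [← hnR]
        exact_mod_cast h
      have h₁ := mul_minorant_le (x := i * k) (by linarith) (by positivity) hlt
      have h₂ := ih (n - i * k) (Nat.sub_lt (by omega) (Nat.mul_pos
        (Finset.mem_Icc.1 hi).1 (Finset.mem_Icc.1 hk).1)) (by omega)
      rw [hsub] at h₂
      push_cast
      calc _ = (k : ℝ) * (1 / 13 * (Real.exp (5 / 2 * R) / R ^ 2 * minorant R (i * k))) := by
            field_simp
        _ ≤ (k : ℝ) * (1 / 13 * (Real.exp (5 / 2 * √(R ^ 2 - i * k)) / (R ^ 2 - i * k))) := by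
            gcongr
        _ = (k : ℝ) * (1 / (13 * (R ^ 2 - i * k)) * Real.exp (5 / 2 * √(R ^ 2 - i * k))) := by
            rw [one_div, one_div, mul_inv, div_eq_mul_inv]
            ring
        _ ≤ _ := by gcongr
    · refine le_trans ?_ (Nat.cast_nonneg _)
      refine mul_nonpos_of_nonneg_of_nonpos (by positivity)
        (mul_nonpos_of_nonneg_of_nonpos (Nat.cast_nonneg k)
          (minorant_nonpos (by linarith) ?_))
      rw [← hnR]
      exact_mod_cast h
  have hsum : 1 / (13 * R ^ 2) * Real.exp (5 / 2 * R) * R ^ 2 <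
      R ^ 2 * (Fintype.card (Nat.Partition n) : ℝ) := by
    calc _ < 1 / (13 * R ^ 2) * Real.exp (5 / 2 * R) *
          ∑ i ∈ Icc (1 : ℕ) 20, ∑ k ∈ Icc 1 n, (k : ℝ) * minorant R (i * k) :=
          mul_lt_mul_of_pos_left ((sq_lt_sum_bound hR22).trans_le (Finset.sum_le_sum fun i hi =>
            le_sum_mul_minorant (by linarith) hnR (Finset.mem_Icc.1 hi).1)) (by positivity)
      _ ≤ ∑ k ∈ Icc 1 n, ∑ i ∈ Icc 1 20,
          ((if i * k ≤ n then k * Fintype.card (Nat.Partition (n - i * k)) else 0 : ℕ) : ℝ) := by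
          rw [Finset.sum_comm, Finset.mul_sum]
          refine Finset.sum_le_sum fun k hk => ?_
          rw [Finset.mul_sum]
          exact Finset.sum_le_sum (hterm k hk)
      _ ≤ ((n * Fintype.card (Nat.Partition n) : ℕ) : ℝ) := by
          exact_mod_cast (Finset.sum_le_sum fun k _ => Finset.sum_le_sum_of_subset
            (Finset.Icc_subset_Icc_right (by omega))).trans (sum_mul_card_partition_le n)
      _ = R ^ 2 * (Fintype.card (Nat.Partition n) : ℝ) := by rw [Nat.cast_mul, hnR]
  rw [mul_comm] at hsum
  exact lt_of_mul_lt_mul_left hsum hR2.le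

/-- Maróti's bound: p(n) > (1/(13n))·exp((5/2)√n) for all n ≥ 1,
where p(n) is the number of integer partitions of n. -/
theorem stmt_14 (n : ℕ) (hn : 1 ≤ n) :
    (1 / (13 * (n : ℝ))) * Real.exp ((5 / 2) * Real.sqrt n) <
      (Fintype.card (Nat.Partition n) : ℝ) := by
  induction n using Nat.strong_induction_on with
  | _ n ih =>
    rcases lt_or_ge n 484 with h | h
    · have := exp_sqrt_lt_card_partition_of_le hn (show n ≤ 483 by omega)
      rw [one_div, inv_mul_lt_iff₀ (by positivity)]
      exact this
    · exact exp_sqrt_lt_card_partition_of_forall_lt h ih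
end
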